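/- arXiv:1204.3855 — 5 statements merged into one kernel-verified Lean document; each statement's English description precedes it below -/
import Mathlib

section
/- Let B be an invertible 2×2 real matrix and Λ = Λ(B) = {Bp : p ∈ ℤ²}, and let m = min{‖v‖ : v ∈ Λ, v ≠ 0}. If the set of minimal vectors {v ∈ Λ : ‖v‖ = m} has exactly 6 elements, then Λ is a regular hexagonal lattice: there exist minimal vectors v, w ∈ Λ with ‖v‖ = ‖w‖ = m and inner product ⟨v, w⟩ = m²/2 (i.e. v and w draw an angle of π/3) such that Λ = {av + bw : a, b ∈ ℤ}. -/
open scoped RealInnerProductSpace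

/-- The planar lattice generated by a 2×2 real matrix `B`, viewed inside the
Euclidean plane: `Λ(B) = {Bp : p ∈ ℤ²}`. -/
noncomputable def latticeGen (B : Matrix (Fin 2) (Fin 2) ℝ) :
    Set (EuclideanSpace ℝ (Fin 2)) :=
  { x | ∃ p : Fin 2 → ℤ,
      x = (WithLp.equiv 2 (Fin 2 → ℝ)).symm (B.mulVec (fun i => (p i : ℝ))) }

/-- The lattice generated by a matrix, as an additive subgroup of the plane. -/
noncomputable def latticeGenAddSubgroup (B : Matrix (Fin 2) (Fin 2) ℝ) :
    AddSubgroup (EuclideanSpace ℝ (Fin 2)) where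
  carrier := latticeGen B
  zero_mem' := ⟨0, by ext i; fin_cases i <;> simp⟩
  add_mem' := by
    rintro _ _ ⟨p, rfl⟩ ⟨q, rfl⟩
    refine ⟨p + q, ?_⟩
    ext i
    fin_cases i <;> simp <;> ring
  neg_mem' := by
    rintro _ ⟨p, rfl⟩
    refine ⟨-p, ?_⟩
    ext i
    fin_cases i <;> simp <;> ring

section MinimalVectors

variable {E : Type*} [NormedAddCommGroup E] [InnerProductSpace ℝ E]

lemma norm_sq_smul_add_smul {v w : E} {m : ℝ} (hv : ‖v‖ = m) (hw : ‖w‖ = m) (a b : ℝ) :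
    ‖a • v + b • w‖ ^ 2 = (a ^ 2 + b ^ 2) * m ^ 2 + 2 * (a * b) * ⟪v, w⟫ := by
  rw [norm_add_sq_real, norm_smul, norm_smul, mul_pow, mul_pow, inner_smul_left,
    inner_smul_right, hv, hw]
  simp only [Real.norm_eq_abs, sq_abs, conj_trivial]
  ring

/-- Two non-opposite distinct vectors of minimal norm `m` in a discrete subgroup have inner
product at most `m² / 2` in absolute value. -/
lemma abs_inner_le_of_minimal {Λ : AddSubgroup E} {m : ℝ} (hm : 0 < m)
    (hmin : ∀ u ∈ Λ, u ≠ 0 → m ≤ ‖u‖) {v w : E} (hvΛ : v ∈ Λ) (hwΛ : w ∈ Λ)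
    (hv : ‖v‖ = m) (hw : ‖w‖ = m) (hne : w ≠ v) (hne' : w ≠ -v) :
    |⟪v, w⟫| ≤ m ^ 2 / 2 := by
  have hadd := hmin (v + w) (Λ.add_mem hvΛ hwΛ) fun h => hne' (neg_eq_of_add_eq_zero_right h).symm
  have hsub := hmin (v - w) (Λ.sub_mem hvΛ hwΛ) fun h => hne (sub_eq_zero.mp h).symm
  have hadd' := pow_le_pow_left₀ hm.le hadd 2
  have hsub' := pow_le_pow_left₀ hm.le hsub 2
  rw [norm_add_sq_real, hv, hw] at hadd'
  rw [norm_sub_sq_real, hv, hw] at hsub'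
  rw [abs_le]
  constructor <;> linarith

/-- A vector of a discrete subgroup with coordinates at most `1 / 2` in two minimal vectors
vanishes. -/
lemma eq_zero_of_abs_coords_le_half {Λ : AddSubgroup E} {m : ℝ} (hm : 0 < m)
    (hmin : ∀ u ∈ Λ, u ≠ 0 → m ≤ ‖u‖) {v w : E} (hv : ‖v‖ = m) (hw : ‖w‖ = m)
    (hc : |⟪v, w⟫| ≤ m ^ 2 / 2) {s t : ℝ} (hs : |s| ≤ 1 / 2) (ht : |t| ≤ 1 / 2)
    (hmem : s • v + t • w ∈ Λ) : s • v + t • w = 0 := by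
  by_contra h
  have hle := pow_le_pow_left₀ hm.le (hmin _ hmem h) 2
  rw [norm_sq_smul_add_smul hv hw] at hle
  have hs2 : s ^ 2 ≤ 1 / 4 := by
    rw [← sq_abs]; nlinarith [abs_nonneg s]
  have ht2 : t ^ 2 ≤ 1 / 4 := by
    rw [← sq_abs]; nlinarith [abs_nonneg t]
  have hst : |s * t| ≤ 1 / 4 := by
    rw [abs_mul]; nlinarith [abs_nonneg s, abs_nonneg t]
  have hprod : s * t * ⟪v, w⟫ ≤ 1 / 4 * (m ^ 2 / 2) :=
    (le_abs_self _).trans (by rw [abs_mul]; gcongr)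
  nlinarith [sq_pos_of_pos hm]

/-- If the inner product of two vectors of norm `m` is less than `m² / 2` in absolute value,
then the only integer combinations of norm `m` are the two vectors and their opposites. -/
lemma eq_or_eq_neg_of_norm_eq {m : ℝ} (hm : 0 < m) {v w : E} (hv : ‖v‖ = m) (hw : ‖w‖ = m)
    (hc : |⟪v, w⟫| < m ^ 2 / 2) {a b : ℤ} (hx : ‖a • v + b • w‖ = m) :
    a • v + b • w ∈ ({v, -v, w, -w} : Set E) := by
  have hm2 : 0 < m ^ 2 := by positivity
  have hsq := norm_sq_smul_add_smul hv hw (a : ℝ) (b : ℝ)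
  rw [Int.cast_smul_eq_zsmul, Int.cast_smul_eq_zsmul, hx] at hsq
  have hab : a = 0 ∨ b = 0 := by
    by_contra! hab
    have hpos : 0 < |(a : ℝ) * b| :=
      abs_pos.mpr (mul_ne_zero (mod_cast hab.1) (mod_cast hab.2))
    have hone : 1 ≤ |(a : ℝ) * b| := by
      exact_mod_cast Int.one_le_abs (mul_ne_zero hab.1 hab.2)
    have hlow : -(|(a : ℝ) * b| * |⟪v, w⟫|) ≤ a * b * ⟪v, w⟫ := by
      rw [← abs_mul]; exact neg_abs_le _
    have hlt := mul_lt_mul_of_pos_left hc hpos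
    have hamgm : 2 * |(a : ℝ) * b| ≤ a ^ 2 + b ^ 2 := by
      rw [abs_mul, ← sq_abs (a : ℝ), ← sq_abs (b : ℝ)]
      nlinarith [sq_nonneg (|(a : ℝ)| - |(b : ℝ)|)]
    nlinarith
  have hunit (n : ℤ) (h : m ^ 2 = (n : ℝ) ^ 2 * m ^ 2) : n = 1 ∨ n = -1 := by
    have h1 : (n : ℝ) ^ 2 = 1 := mul_right_cancel₀ hm2.ne' (by linarith)
    exact sq_eq_one_iff.mp (by exact_mod_cast h1)
  rcases hab with rfl | rfl
  · rcases hunit b (by simpa using hsq) with rfl | rfl <;> simp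
  · rcases hunit a (by simpa using hsq) with rfl | rfl <;> simp

end MinimalVectors

/-- Two plane vectors of norm `m > 0` with inner product at most `m² / 2` in absolute value
span the plane. -/
lemma exists_coords_of_abs_inner_le {m : ℝ} (hm : 0 < m) {v w : EuclideanSpace ℝ (Fin 2)}
    (hv : ‖v‖ = m) (hw : ‖w‖ = m) (hc : |⟪v, w⟫| ≤ m ^ 2 / 2)
    (x : EuclideanSpace ℝ (Fin 2)) : ∃ s t : ℝ, x = s • v + t • w := by
  have hv2 : v 0 ^ 2 + v 1 ^ 2 = m ^ 2 := by
    rw [← hv, EuclideanSpace.real_norm_sq_eq, Fin.sum_univ_two]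
  have hw2 : w 0 ^ 2 + w 1 ^ 2 = m ^ 2 := by
    rw [← hw, EuclideanSpace.real_norm_sq_eq, Fin.sum_univ_two]
  have hvw : ⟪v, w⟫ = v 0 * w 0 + v 1 * w 1 := by
    simp [PiLp.inner_apply, Fin.sum_univ_two, mul_comm]
  have hD : v 0 * w 1 - v 1 * w 0 ≠ 0 := by
    intro h
    have hlagrange : (v 0 * w 0 + v 1 * w 1) ^ 2 = m ^ 2 * m ^ 2 := by
      linear_combination -(v 0 * w 1 - v 1 * w 0) * h + (w 0 ^ 2 + w 1 ^ 2) * hv2 + m ^ 2 * hw2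
    have hsq := pow_le_pow_left₀ (abs_nonneg _) hc 2
    rw [sq_abs, hvw, hlagrange] at hsq
    have : 0 < m ^ 2 * m ^ 2 := by positivity
    linarith
  refine ⟨(x 0 * w 1 - x 1 * w 0) / (v 0 * w 1 - v 1 * w 0),
    (v 0 * x 1 - v 1 * x 0) / (v 0 * w 1 - v 1 * w 0), ?_⟩
  ext i
  fin_cases i <;>
  · simp only [Fin.zero_eta, Fin.mk_one, PiLp.add_apply, PiLp.smul_apply, smul_eq_mul]
    rw [div_mul_eq_mul_div, div_mul_eq_mul_div, ← add_div, eq_div_iff hD]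
    ring

/-- Two minimal vectors of a planar lattice with inner product at most `m² / 2` in absolute value
generate the lattice. -/
lemma exists_int_coords_of_minimal {Λ : AddSubgroup (EuclideanSpace ℝ (Fin 2))} {m : ℝ}
    (hm : 0 < m) (hmin : ∀ u ∈ Λ, u ≠ 0 → m ≤ ‖u‖) {v w : EuclideanSpace ℝ (Fin 2)}
    (hvΛ : v ∈ Λ) (hwΛ : w ∈ Λ) (hv : ‖v‖ = m) (hw : ‖w‖ = m)
    (hc : |⟪v, w⟫| ≤ m ^ 2 / 2) {x : EuclideanSpace ℝ (Fin 2)} (hx : x ∈ Λ) :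
    ∃ a b : ℤ, x = a • v + b • w := by
  obtain ⟨s, t, rfl⟩ := exists_coords_of_abs_inner_le hm hv hw hc x
  refine ⟨round s, round t, sub_eq_zero.mp ?_⟩
  have hdiff : s • v + t • w - (round s • v + round t • w) =
      (s - round s) • v + (t - round t) • w := by
    simp only [sub_smul, Int.cast_smul_eq_zsmul]
    abel
  have hmem := Λ.sub_mem hx (Λ.add_mem (Λ.zsmul_mem hvΛ (round s)) (Λ.zsmul_mem hwΛ (round t)))
  rw [hdiff] at hmem ⊢
  exact eq_zero_of_abs_coords_le_half hm hmin hv hw hc (abs_sub_round s) (abs_sub_round t) hmem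

/-- If a planar lattice has exactly six minimal vectors, then it is a regular
hexagonal lattice: it is generated by two minimal vectors drawing an angle of
`π/3` (i.e. with inner product `m²/2`). -/
theorem hexagonal_of_six_minimal_vectors (B : Matrix (Fin 2) (Fin 2) ℝ)
    (hB : B.det ≠ 0) (m : ℝ)
    (hm : IsLeast {r : ℝ | ∃ v ∈ latticeGen B, v ≠ 0 ∧ ‖v‖ = r} m)
    (hsix : {v ∈ latticeGen B | ‖v‖ = m}.encard = 6) :
    ∃ v w : EuclideanSpace ℝ (Fin 2),
      v ∈ latticeGen B ∧ w ∈ latticeGen B ∧ ‖v‖ = m ∧ ‖w‖ = m ∧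
      ⟪v, w⟫ = m ^ 2 / 2 ∧
      latticeGen B = { x | ∃ a b : ℤ, x = a • v + b • w } := by
  obtain ⟨⟨u, -, hu0, hum⟩, hlow⟩ := hm
  have hm0 : 0 < m := hum ▸ norm_pos_iff.mpr hu0
  let Λ := latticeGenAddSubgroup B
  have hmin : ∀ u ∈ Λ, u ≠ 0 → m ≤ ‖u‖ := fun u hu hu0 => hlow ⟨u, hu, hu0, rfl⟩
  have hexists (T : Finset (EuclideanSpace ℝ (Fin 2))) (hT : T.card ≤ 4) :
      ∃ x, (x ∈ Λ ∧ ‖x‖ = m) ∧ x ∉ T := by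
    by_contra! hsub
    have hle : {v ∈ latticeGen B | ‖v‖ = m}.encard ≤ (T : Set _).encard :=
      Set.encard_le_encard fun x hx => hsub x hx
    rw [hsix, Set.encard_coe_eq_coe_finsetCard] at hle
    have : 6 ≤ T.card := by exact_mod_cast hle
    omega
  classical
  obtain ⟨v, ⟨hvΛ, hv⟩, -⟩ := hexists ∅ (by simp)
  obtain ⟨w, ⟨hwΛ, hw⟩, hwv⟩ := hexists {v, -v} (Finset.card_le_two.trans (by norm_num))
  simp only [Finset.mem_insert, Finset.mem_singleton, not_or] at hwv
  have hc := abs_inner_le_of_minimal hm0 hmin hvΛ hwΛ hv hw hwv.1 hwv.2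
  obtain ⟨w, hwΛ, hw, hvw⟩ : ∃ w ∈ Λ, ‖w‖ = m ∧ ⟪v, w⟫ = m ^ 2 / 2 := by
    rcases hc.lt_or_eq with hlt | heq
    · obtain ⟨x, ⟨hxΛ, hx⟩, hxT⟩ := hexists {v, -v, w, -w} Finset.card_le_four
      obtain ⟨a, b, rfl⟩ := exists_int_coords_of_minimal hm0 hmin hvΛ hwΛ hv hw hc hxΛ
      exact absurd (eq_or_eq_neg_of_norm_eq hm0 hv hw hlt hx) (by simpa using hxT)
    · rcases (abs_eq (by positivity)).mp heq with h | h
      · exact ⟨w, hwΛ, hw, h⟩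
      · exact ⟨-w, Λ.neg_mem hwΛ, by rwa [norm_neg], by rw [inner_neg_right, h, neg_neg]⟩
  refine ⟨v, w, hvΛ, hwΛ, hv, hw, hvw, Set.Subset.antisymm ?_ ?_⟩
  · intro x hx
    refine exists_int_coords_of_minimal (Λ := Λ) hm0 hmin hvΛ hwΛ hv hw ?_ hx
    rw [hvw, abs_of_nonneg (by positivity)]
  · rintro _ ⟨a, b, rfl⟩
    exact Λ.add_mem (Λ.zsmul_mem hvΛ a) (Λ.zsmul_mem hwΛ b)
end

section
/- Let P be a finite set of lattice sites, ω : P × P → ℝ a nonnegative symmetric weight function, and L ≥ 1 a natural number. For a discrete image u : P → {0, …, L−1} define its discrete total variation as TV(u) = Σ_{(p,q) ∈ P×P} ω(p,q)·|u(p) − u(q)|, and for each level l ∈ {0, …, L−1} define the binary image χ^l : P → {0,1} by χ^l(p) = 1 if u(p) > l and 0 otherwise. Then the discrete total variation satisfies the discrete coarea formula: TV(u) = Σ_{l=0}^{L−2} TV(χ^l), i.e. Σ_{(p,q)} ω(p,q)|u(p) − u(q)| = Σ_{l=0}^{L−2} Σ_{(p,q)} ω(p,q)|χ^l(p) − χ^l(q)|.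 -/
/-- A natural number `a ≤ n` is the number of levels `l < n` lying below it. -/
theorem sum_range_ite_lt {a n : ℕ} (ha : a ≤ n) :
    ∑ l ∈ Finset.range n, (if l < a then (1 : ℝ) else 0) = a := by
  have hfilter : (Finset.range n).filter (· < a) = Finset.range a := by
    ext l
    simp only [Finset.mem_filter, Finset.mem_range]
    omega
  rw [Finset.sum_boole, hfilter, Finset.card_range]

/-- The distance of two grey levels is the number of thresholds separating them. -/
theorem abs_sub_eq_sum_range_abs_sub_ite {a b n : ℕ} (ha : a ≤ n) (hb : b ≤ n) :
    |(a : ℝ) - b| = ∑ l ∈ Finset.range n,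
      |(if l < a then (1 : ℝ) else 0) - (if l < b then (1 : ℝ) else 0)| := by
  wlog hab : b ≤ a generalizing a b
  · simpa only [abs_sub_comm] using this hb ha (le_of_not_ge hab)
  have hlevel (l : ℕ) : |(if l < a then (1 : ℝ) else 0) - (if l < b then (1 : ℝ) else 0)| =
      (if l < a then (1 : ℝ) else 0) - (if l < b then (1 : ℝ) else 0) := by
    apply abs_of_nonneg
    split_ifs <;> first | omega | norm_num
  simp only [hlevel, Finset.sum_sub_distrib, sum_range_ite_lt ha, sum_range_ite_lt hb]
  exact abs_of_nonneg (sub_nonneg.2 (Nat.cast_le.2 hab))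

/-- The discrete coarea formula: the discrete total variation of a discrete
image `u : P → {0, …, L−1}` with nonnegative symmetric weights `ω` equals the
sum over all levels `l = 0, …, L−2` of the discrete total variations of its
binary super level images `χ^l`. -/
theorem discrete_coarea (P : Type*) [Fintype P] (ω : P → P → ℝ)
    (hω : ∀ p q, 0 ≤ ω p q) (hsym : ∀ p q, ω p q = ω q p)
    (L : ℕ) (hL : 1 ≤ L) (u : P → ℕ) (hu : ∀ p, u p < L) :
    ∑ p : P, ∑ q : P, ω p q * |(u p : ℝ) - (u q : ℝ)| =
      ∑ l ∈ Finset.range (L - 1), ∑ p : P, ∑ q : P,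
        ω p q * |(if l < u p then (1 : ℝ) else 0) - (if l < u q then (1 : ℝ) else 0)| := by
  rw [Finset.sum_comm (s := Finset.range (L - 1))]
  refine Finset.sum_congr rfl fun p _ => ?_
  rw [Finset.sum_comm (s := Finset.range (L - 1))]
  refine Finset.sum_congr rfl fun q _ => ?_
  rw [← Finset.mul_sum, ← abs_sub_eq_sum_range_abs_sub_ite
    (Nat.le_sub_one_of_lt (hu p)) (Nat.le_sub_one_of_lt (hu q))]
end

section
/- For all real numbers x₁, x₂, y₁, y₂, the absolute-difference pairwise term is submodular: |max(x₁, y₁) − max(x₂, y₂)| + |min(x₁, y₁) − min(x₂, y₂)| ≤ |x₁ − x₂| + |y₁ − y₂|. -/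
/-- The absolute-difference pairwise term is submodular:
`|max(x₁,y₁) − max(x₂,y₂)| + |min(x₁,y₁) − min(x₂,y₂)| ≤ |x₁ − x₂| + |y₁ − y₂|`. -/
theorem abs_diff_submodular (x₁ x₂ y₁ y₂ : ℝ) :
    |max x₁ y₁ - max x₂ y₂| + |min x₁ y₁ - min x₂ y₂| ≤ |x₁ - x₂| + |y₁ - y₂| := by
  rcases le_total x₁ y₁ with h₁ | h₁ <;> rcases le_total x₂ y₂ with h₂ | h₂ <;>
    simp only [max_eq_left, max_eq_right, min_eq_left, min_eq_right, h₁, h₂] <;>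
    grind
end

section
/- Let P be a finite set of lattice sites and ω : P × P → ℝ a nonnegative symmetric weight function, and define the discrete total variation of u : P → ℝ as TV(u) = Σ_{(p,q) ∈ P×P} ω(p,q)·|u(p) − u(q)|. Then TV is submodular: for all u, v : P → ℝ, TV(u ∨ v) + TV(u ∧ v) ≤ TV(u) + TV(v), where (u ∨ v)(p) = max(u(p), v(p)) and (u ∧ v)(p) = min(u(p), v(p)). -/
/-- The function `(x, y) ↦ |x - y|` is submodular on `ℝ × ℝ`. -/
theorem abs_max_sub_max_add_abs_min_sub_min_le (a b c d : ℝ) :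
    |max a b - max c d| + |min a b - min c d| ≤ |a - c| + |b - d| := by
  rcases le_total a b with hab | hab <;> rcases le_total c d with hcd | hcd <;>
    simp only [max_eq_left, max_eq_right, min_eq_left, min_eq_right, hab, hcd] <;>
    grind

/-- The discrete total variation with nonnegative symmetric weights is
submodular: `TV(u ∨ v) + TV(u ∧ v) ≤ TV(u) + TV(v)` with pointwise maximum
and minimum. -/
theorem discreteTV_submodular (P : Type*) [Fintype P] (ω : P → P → ℝ)
    (hω : ∀ p q, 0 ≤ ω p q) (hsym : ∀ p q, ω p q = ω q p) (u v : P → ℝ) :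
    (∑ p : P, ∑ q : P, ω p q * |max (u p) (v p) - max (u q) (v q)|) +
      (∑ p : P, ∑ q : P, ω p q * |min (u p) (v p) - min (u q) (v q)|) ≤
    (∑ p : P, ∑ q : P, ω p q * |u p - u q|) +
      (∑ p : P, ∑ q : P, ω p q * |v p - v q|) := by
  simp only [← Finset.sum_add_distrib, ← mul_add]
  exact Finset.sum_le_sum fun p _ => Finset.sum_le_sum fun q _ =>
    mul_le_mul_of_nonneg_left
      (abs_max_sub_max_add_abs_min_sub_min_le (u p) (v p) (u q) (v q)) (hω p q)
end

section
/- Let d > 0 and let Λ(dH) = {dHp : p ∈ ℤ²} be the regular hexagonal lattice, where H has columns h₁ = (1, 0) and h₂ = (1/2, √3/2). Let M = {±dh₁, ±dh₂, ±d(h₂ − h₁)} be the six minimal (nearest-neighbour) vectors of the lattice. Then the Voronoi cell of the origin, V(0) = {x ∈ ℝ² : ‖x‖ ≤ ‖x − q‖ for all q ∈ Λ(dH), q ≠ 0}, equals the intersection of the six half-planes determined by the minimal vectors: V(0) = {x ∈ ℝ² : ⟨x, v⟩ ≤ d²/2 for all v ∈ M}. -/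
open scoped RealInnerProductSpace

/-- The generator matrix of the horizontally aligned regular hexagonal lattice,
with columns `h₁ = (1, 0)` and `h₂ = (1/2, √3/2)`. -/
noncomputable def hexMat : Matrix (Fin 2) (Fin 2) ℝ :=
  !![1, 1/2; 0, Real.sqrt 3 / 2]

/-- The point of the Euclidean plane with coordinates `(a, b)`. -/
noncomputable def pt (a b : ℝ) : EuclideanSpace ℝ (Fin 2) :=
  (WithLp.equiv 2 (Fin 2 → ℝ)).symm ![a, b]

/-- The six minimal (nearest-neighbour) vectors `±dh₁, ±dh₂, ±d(h₂ − h₁)` of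
the regular hexagonal lattice `Λ(dH)`. -/
noncomputable def hexMinimalVectors (d : ℝ) : Set (EuclideanSpace ℝ (Fin 2)) :=
  { pt d 0, pt (-d) 0,
    pt (d / 2) (d * Real.sqrt 3 / 2), pt (-(d / 2)) (-(d * Real.sqrt 3 / 2)),
    pt (-(d / 2)) (d * Real.sqrt 3 / 2), pt (d / 2) (-(d * Real.sqrt 3 / 2)) }

/-- The half-plane inequality for a nonnegative integral combination of two vectors generating a
sextant of the hexagonal lattice, `p` and `q` being the inner products with these vectors. -/
theorem nat_combination_le_hex_form (s t : ℤ) (hs : 0 ≤ s) (ht : 0 ≤ t) (p q c : ℝ)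
    (hc : 0 ≤ c) (hp : p ≤ c) (hq : q ≤ c) :
    s * p + t * q ≤ c * ((s : ℝ) ^ 2 + s * t + (t : ℝ) ^ 2) := by
  have hform : s + t ≤ s ^ 2 + s * t + t ^ 2 := by
    have := Int.le_self_sq s
    have := Int.le_self_sq t
    have := mul_nonneg hs ht
    linarith
  have hs' : (0 : ℝ) ≤ s := by exact_mod_cast hs
  have ht' : (0 : ℝ) ≤ t := by exact_mod_cast ht
  calc (s : ℝ) * p + t * q ≤ s * c + t * c := by gcongr
    _ = c * ((s + t : ℤ) : ℝ) := by push_cast; ring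
    _ ≤ c * ((s ^ 2 + s * t + t ^ 2 : ℤ) : ℝ) := by gcongr
    _ = _ := by push_cast; ring

/-- The half-plane inequalities for the six minimal vectors of the hexagonal lattice imply those
for all lattice vectors; here `u` and `w` are the inner products with the two generators. -/
theorem int_combination_le_hex_form (a b : ℤ) (u w c : ℝ) (hu : |u| ≤ c) (hw : |w| ≤ c)
    (huw : |w - u| ≤ c) :
    a * u + b * w ≤ c * ((a : ℝ) ^ 2 + a * b + (b : ℝ) ^ 2) := by
  have hc : 0 ≤ c := (abs_nonneg u).trans hu
  obtain ⟨hu₁, hu₂⟩ := abs_le.mp hu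
  obtain ⟨hw₁, hw₂⟩ := abs_le.mp hw
  obtain ⟨huw₁, huw₂⟩ := abs_le.mp huw
  rcases le_total 0 a with ha | ha <;> rcases le_total 0 b with hb | hb
  · exact nat_combination_le_hex_form a b ha hb u w c hc hu₂ hw₂
  · rcases le_total 0 (a + b) with hab | hab
    · have := nat_combination_le_hex_form (a + b) (-b) hab (by lia) u (u - w) c hc hu₂
        (by linarith)
      push_cast at this
      linarith
    · have := nat_combination_le_hex_form a (-(a + b)) ha (by lia) (u - w) (-w) c hc
        (by linarith) (by linarith)
      push_cast at this
      linarith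
  · rcases le_total 0 (a + b) with hab | hab
    · have := nat_combination_le_hex_form (a + b) (-a) hab (by lia) w (w - u) c hc hw₂ huw₂
      push_cast at this
      linarith
    · have := nat_combination_le_hex_form b (-(a + b)) hb (by lia) (w - u) (-u) c hc
        huw₂ (by linarith)
      push_cast at this
      linarith
  · have := nat_combination_le_hex_form (-a) (-b) (by lia) (by lia) (-u) (-w) c hc
      (by linarith) (by linarith)
    push_cast at this
    linarith

theorem norm_le_norm_sub_iff_inner_le {E : Type*} [NormedAddCommGroup E] [InnerProductSpace ℝ E]
    (x q : E) : ‖x‖ ≤ ‖x - q‖ ↔ ⟪x, q⟫ ≤ ‖q‖ ^ 2 / 2 := by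
  rw [← sq_le_sq₀ (norm_nonneg _) (norm_nonneg _), norm_sub_sq_real]
  constructor <;> intro h <;> linarith

theorem inner_pt (x : EuclideanSpace ℝ (Fin 2)) (a b : ℝ) : ⟪x, pt a b⟫ = x 0 * a + x 1 * b := by
  simp [pt, PiLp.inner_apply, Fin.sum_univ_two, mul_comm]

theorem norm_pt_sq (a b : ℝ) : ‖pt a b‖ ^ 2 = a ^ 2 + b ^ 2 := by
  simp [pt, EuclideanSpace.norm_sq_eq, Fin.sum_univ_two]

theorem mem_latticeGen_smul_hexMat (d : ℝ) (q : EuclideanSpace ℝ (Fin 2)) :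
    q ∈ latticeGen (d • hexMat) ↔
      ∃ a b : ℤ, q = pt (d * (a + b / 2)) (d * (b * Real.sqrt 3 / 2)) := by
  have key (p : Fin 2 → ℤ) : (WithLp.equiv 2 (Fin 2 → ℝ)).symm
      ((d • hexMat).mulVec fun i => (p i : ℝ)) =
      pt (d * (p 0 + p 1 / 2)) (d * (p 1 * Real.sqrt 3 / 2)) := by
    ext i
    fin_cases i <;> simp [hexMat, pt, dotProduct, Fin.sum_univ_two] <;> ring
  constructor
  · rintro ⟨p, rfl⟩
    exact ⟨p 0, p 1, key p⟩
  · rintro ⟨a, b, rfl⟩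
    exact ⟨![a, b], (key ![a, b]).symm⟩

theorem norm_sq_of_mem_hexMinimalVectors {d : ℝ} {v : EuclideanSpace ℝ (Fin 2)}
    (hv : v ∈ hexMinimalVectors d) : ‖v‖ ^ 2 = d ^ 2 := by
  have h3 : Real.sqrt 3 ^ 2 = 3 := Real.sq_sqrt (by norm_num)
  rcases hv with rfl | rfl | rfl | rfl | rfl | rfl <;> rw [norm_pt_sq] <;> grind

theorem hexMinimalVectors_subset_latticeGen (d : ℝ) :
    hexMinimalVectors d ⊆ latticeGen (d • hexMat) := by
  intro v hv
  rw [mem_latticeGen_smul_hexMat]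
  rcases hv with rfl | rfl | rfl | rfl | rfl | rfl
  · exact ⟨1, 0, by congr 1 <;> push_cast <;> ring⟩
  · exact ⟨-1, 0, by congr 1 <;> push_cast <;> ring⟩
  · exact ⟨0, 1, by congr 1 <;> push_cast <;> ring⟩
  · exact ⟨0, -1, by congr 1 <;> push_cast <;> ring⟩
  · exact ⟨-1, 1, by congr 1 <;> push_cast <;> ring⟩
  · exact ⟨1, -1, by congr 1 <;> push_cast <;> ring⟩

/-- The Voronoi cell of the origin of the regular hexagonal lattice `Λ(dH)`
equals the intersection of the six half-planes determined by the six minimal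
vectors of the lattice. -/
theorem hex_voronoi_eq_halfplanes (d : ℝ) (hd : 0 < d) :
    { x : EuclideanSpace ℝ (Fin 2) |
        ∀ q ∈ latticeGen (d • hexMat), q ≠ 0 → ‖x‖ ≤ ‖x - q‖ } =
      { x : EuclideanSpace ℝ (Fin 2) |
        ∀ v ∈ hexMinimalVectors d, ⟪x, v⟫ ≤ d ^ 2 / 2 } := by
  ext x
  simp only [Set.mem_ofPred_eq, norm_le_norm_sub_iff_inner_le]
  constructor
  · intro h v hv
    have hnorm := norm_sq_of_mem_hexMinimalVectors hv
    rw [← hnorm]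
    refine h v (hexMinimalVectors_subset_latticeGen d hv) ?_
    rintro rfl
    simp only [norm_zero] at hnorm
    nlinarith
  · intro h q hq _
    obtain ⟨a, b, rfl⟩ := (mem_latticeGen_smul_hexMat d q).mp hq
    simp only [hexMinimalVectors, Set.mem_insert_iff, Set.mem_singleton_iff, forall_eq_or_imp,
      forall_eq, inner_pt] at h
    obtain ⟨h₁, h₂, h₃, h₄, h₅, h₆⟩ := h
    have h3 : Real.sqrt 3 ^ 2 = 3 := Real.sq_sqrt (by norm_num)
    have key := int_combination_le_hex_form a b (x 0 * d)
      (x 0 * (d / 2) + x 1 * (d * Real.sqrt 3 / 2)) (d ^ 2 / 2)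
      (abs_le.mpr ⟨by linarith, by linarith⟩) (abs_le.mpr ⟨by linarith, by linarith⟩)
      (abs_le.mpr ⟨by linarith, by linarith⟩)
    rw [inner_pt, norm_pt_sq]
    have hform : (d * (a + b / 2)) ^ 2 + (d * (b * Real.sqrt 3 / 2)) ^ 2 =
        d ^ 2 * ((a : ℝ) ^ 2 + a * b + (b : ℝ) ^ 2) := by
      linear_combination d ^ 2 * b ^ 2 / 4 * h3
    rw [hform]
    linarith
end
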